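/- arXiv:2105.02456 — 2 statements merged into one kernel-verified Lean document; each statement's English description precedes it below -/
import Mathlib

section
/- Let C̃, C, D̃, D be categories, let F̃ : C̃ → D̃ and F : C → D be functors admitting right adjoints F̃ᴿ and Fᴿ respectively, let M : D̃ → D be a functor, and let L : C̃ → C be a localization functor. Suppose given a natural isomorphism M ∘ F̃ ≅ F ∘ L. Then the mate natural transformation L ∘ F̃ᴿ ⟹ Fᴿ ∘ M exhibits Fᴿ as a left Kan extension of L ∘ F̃ᴿ along M. -/
open CategoryTheory

namespace CategoryTheory

variable {Ct C Dt D : Type*} [Category Ct] [Category C] [Category Dt] [Category D]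
    {Ft : Ct ⥤ Dt} {F : C ⥤ D} {FtR : Dt ⥤ Ct} {FR : D ⥤ C}
    (adjt : Ft ⊣ FtR) (adj : F ⊣ FR) {M : Dt ⥤ D} {L : Ct ⥤ C}

/-- If precomposition with `L` is full and `μ` is compatible with the counits of the two
adjunctions, every natural transformation `FtR ⋙ L ⟶ M ⋙ G` factors through `μ`. -/
lemma exists_comp_whiskerLeft_eq_of_counit (α : Ft ⋙ M ≅ L ⋙ F) (μ : FtR ⋙ L ⟶ M ⋙ FR)
    (hμ : ∀ X, F.map (μ.app X) ≫ adj.counit.app (M.obj X) =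
      α.inv.app (FtR.obj X) ≫ M.map (adjt.counit.app X))
    [((Functor.whiskeringLeft Ct C C).obj L).Full] {G : D ⥤ C} (β : FtR ⋙ L ⟶ M ⋙ G) :
    ∃ γ : FR ⟶ G, μ ≫ Functor.whiskerLeft M γ = β := by
  obtain ⟨τ, hτ⟩ := ((Functor.whiskeringLeft Ct C C).obj L).map_surjective
    (X := 𝟭 C) (Y := F ⋙ G)
    { app X := L.map (adjt.unit.app X) ≫ β.app (Ft.obj X) ≫ G.map (α.hom.app X)
      naturality X Y f := by
        have h₁ := adjt.unit.naturality f
        have h₂ := β.naturality (Ft.map f)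
        have h₃ := α.hom.naturality f
        dsimp at h₁ h₂ h₃ ⊢
        rw [← L.map_comp_assoc, h₁, L.map_comp_assoc, reassoc_of% h₂, ← G.map_comp, h₃]
        simp }
  replace hτ (X : Ct) : τ.app (L.obj X) =
      L.map (adjt.unit.app X) ≫ β.app (Ft.obj X) ≫ G.map (α.hom.app X) :=
    NatTrans.congr_app hτ X
  refine ⟨{ app Y := τ.app (FR.obj Y) ≫ G.map (adj.counit.app Y)
            naturality Y Z f := ?_ }, ?_⟩
  · have h := τ.naturality (FR.map f)
    dsimp at h ⊢
    rw [reassoc_of% h, Category.assoc, ← G.map_comp, ← G.map_comp, adj.counit_naturality]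
  · ext X
    have h₁ := τ.naturality (μ.app X)
    have h₂ := β.naturality (adjt.counit.app X)
    dsimp at h₁ h₂ ⊢
    rw [reassoc_of% h₁, hτ, ← G.map_comp, hμ]
    simp only [Category.assoc, ← G.map_comp, Iso.hom_inv_id_app_assoc]
    rw [← h₂, ← L.map_comp_assoc]
    simp

/-- If precomposition with `L` is faithful and `μ` is compatible with the units of the two
adjunctions, natural transformations out of `FR` are determined by their composite with `μ`. -/
lemma hom_ext_of_unit (α : Ft ⋙ M ≅ L ⋙ F) (μ : FtR ⋙ L ⟶ M ⋙ FR)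
    (hμ : ∀ X, L.map (adjt.unit.app X) ≫ μ.app (Ft.obj X) =
      adj.unit.app (L.obj X) ≫ FR.map (α.inv.app X))
    [((Functor.whiskeringLeft Ct C C).obj L).Faithful] {G : D ⥤ C} {γ₁ γ₂ : FR ⟶ G}
    (h : μ ≫ Functor.whiskerLeft M γ₁ = μ ≫ Functor.whiskerLeft M γ₂) : γ₁ = γ₂ := by
  have key : adj.unit ≫ Functor.whiskerLeft F γ₁ = adj.unit ≫ Functor.whiskerLeft F γ₂ := by
    apply ((Functor.whiskeringLeft Ct C C).obj L).map_injective
    ext X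
    have h₁ := NatTrans.congr_app h (Ft.obj X)
    have h₂ : adj.unit.app (L.obj X) =
        L.map (adjt.unit.app X) ≫ μ.app (Ft.obj X) ≫ FR.map (α.hom.app X) := by
      rw [reassoc_of% hμ X, ← FR.map_comp]
      simp
    dsimp at h₁ h₂ ⊢
    simp only [h₂, Category.assoc, NatTrans.naturality, reassoc_of% h₁]
  ext Y
  have h₁ := NatTrans.congr_app key (FR.obj Y) =≫ G.map (adj.counit.app Y)
  dsimp at h₁
  simpa only [Category.assoc, ← NatTrans.naturality, adj.right_triangle_components_assoc] using h₁

end CategoryTheory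

/-- Let `F̃ : C̃ ⥤ D̃` and `F : C ⥤ D` have right adjoints `F̃ᴿ` and `Fᴿ`, let `M : D̃ ⥤ D`,
let `L : C̃ ⥤ C` be a localization functor, and suppose given a natural isomorphism
`M ∘ F̃ ≅ F ∘ L`.  Then the mate `L ∘ F̃ᴿ ⟹ Fᴿ ∘ M` exhibits `Fᴿ` as a left Kan extension
of `L ∘ F̃ᴿ` along `M`. -/
theorem stmt8 {Ct C Dt D : Type*} [Category Ct] [Category C] [Category Dt] [Category D]
    (Ft : Ct ⥤ Dt) (F : C ⥤ D) (FtR : Dt ⥤ Ct) (FR : D ⥤ C)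
    (adjt : Ft ⊣ FtR) (adj : F ⊣ FR) (M : Dt ⥤ D) (L : Ct ⥤ C)
    (W : MorphismProperty Ct) [L.IsLocalization W]
    (α : Ft ⋙ M ≅ L ⋙ F) :
    FR.IsLeftKanExtension (mateEquiv adjt adj α.inv) := by
  have : ((Functor.whiskeringLeft Ct C C).obj L).Full := Localization.full_whiskeringLeft L W C
  have : ((Functor.whiskeringLeft Ct C C).obj L).Faithful :=
    Localization.faithful_whiskeringLeft L W C
  choose desc fac using fun G : D ⥤ C ↦
    exists_comp_whiskerLeft_eq_of_counit adjt adj α _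
      (mateEquiv_counit adjt adj α.inv) (G := G)
  exact ⟨⟨Limits.IsInitial.ofUniqueHom
    (fun E ↦ StructuredArrow.homMk (desc E.right E.hom) (fac E.right E.hom))
    fun E m ↦ StructuredArrow.ext _ _ <| hom_ext_of_unit adjt adj α _
      (unit_mateEquiv adjt adj α.inv) <|
      (StructuredArrow.w m).trans (fac E.right E.hom).symm⟩⟩
end

section
/- For an integer i ≥ 0, let T be the 2-periodic complex of R-modules with T_n = R for all n ∈ ℤ and with differential d_n equal to multiplication by (1−σ) for n even and to multiplication by p^{i+1}·N for n odd. Then for every even n the homology H_n(T) is isomorphic as an abelian group to ℤ/p^{i+1}, and H_n(T) = 0 for every odd n. -/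
/-- The homology in degree `n` of the `ℤ`-indexed complex of `A`-modules whose terms are
all `A` and whose differential with source in degree `n` is multiplication by `e n`:
the kernel of multiplication by `e n` modulo the image of multiplication by `e (n+1)`. -/
abbrev hml' {A : Type} [CommRing A] (e : ℤ → A) (n : ℤ) :=
  ↥(LinearMap.ker (LinearMap.lsmul A A (e n))) ⧸
    Submodule.comap (LinearMap.ker (LinearMap.lsmul A A (e n))).subtype
      (LinearMap.range (LinearMap.lsmul A A (e (n + 1))))

/-- The chosen generator `σ`, as an element of the group ring `ℤ[C]`. -/
noncomputable def tG (G : Type) [CommGroup G] (σ : G) : MonoidAlgebra ℤ G :=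
  MonoidAlgebra.of ℤ G σ

/-- The norm element `N = Σ_{j=0}^{m-1} σ^j` of the group ring. -/
noncomputable def NG (G : Type) [CommGroup G] (σ : G) (m : ℕ) : MonoidAlgebra ℤ G :=
  ∑ j ∈ Finset.range m, tG G σ ^ j

/-- The multiplier of the differential with source in degree `n` of the 2-periodic
complex `T`: `(1 - σ)` for `n` even and `p^{i+1}·N` for `n` odd. -/
noncomputable def eT (G : Type) [CommGroup G] (σ : G) (p r i : ℕ) : ℤ → MonoidAlgebra ℤ G :=
  fun n => if Even n then 1 - tG G σ
    else (p : MonoidAlgebra ℤ G) ^ (i + 1) * NG G σ (p ^ r)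

theorem coeff_intCast_mul {G : Type} [CommGroup G] (c : ℤ) (x : MonoidAlgebra ℤ G) (g : G) :
    ((c : MonoidAlgebra ℤ G) * x).coeff g = c * x.coeff g := by
  rw [← zsmul_eq_mul, MonoidAlgebra.coeff_smul_apply, smul_eq_mul]

section

variable {G : Type} [CommGroup G] [Fintype G] {σ : G}

theorem NG_eq_sum (hσ : ∀ x : G, x ∈ Subgroup.zpowers σ) :
    NG G σ (Fintype.card G) = ∑ g : G, MonoidAlgebra.single g 1 := by
  classical
  have hinj : Set.InjOn (fun j => σ ^ j) (Finset.range (Fintype.card G)) := by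
    rw [Fintype.card_eq_nat_card, ← orderOf_eq_card_of_forall_mem_zpowers hσ, Finset.coe_range]
    exact pow_injOn_Iio_orderOf
  have himg : (Finset.range (Fintype.card G)).image (fun j => σ ^ j) = Finset.univ := by
    rw [Fintype.card_eq_nat_card]
    exact IsCyclic.image_range_card hσ
  rw [← himg, Finset.sum_image hinj]
  simp [NG, tG, MonoidAlgebra.single_pow]

theorem NG_coeff (hσ : ∀ x : G, x ∈ Subgroup.zpowers σ) (g : G) :
    (NG G σ (Fintype.card G)).coeff g = 1 := by
  classical
  simp [NG_eq_sum hσ, MonoidAlgebra.coeff_sum, Finsupp.single_apply]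

theorem one_sub_tG_mul_NG (σ : G) :
    (1 - tG G σ) * NG G σ (Fintype.card G) = 0 := by
  rw [NG, mul_neg_geom_sum, tG, ← map_pow, pow_card_eq_one, map_one, sub_self]

/-- Modulo `1 - σ` every element of the group ring is an integer. -/
theorem exists_eq_intCast_add_mul (hσ : ∀ x : G, x ∈ Subgroup.zpowers σ)
    (x : MonoidAlgebra ℤ G) :
    ∃ (c : ℤ) (y : MonoidAlgebra ℤ G), x = c + (1 - tG G σ) * y := by
  induction x using MonoidAlgebra.induction_on with
  | of g =>
    obtain ⟨k, rfl⟩ := mem_powers_iff_mem_zpowers.mpr (hσ g)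
    obtain ⟨y, hy⟩ := sub_dvd_pow_sub_pow 1 (tG G σ) k
    refine ⟨1, -y, ?_⟩
    rw [mul_neg, ← hy]
    simp [tG, MonoidAlgebra.single_pow]
  | add x x' hx hx' =>
    obtain ⟨c, y, rfl⟩ := hx
    obtain ⟨c', y', rfl⟩ := hx'
    exact ⟨c + c', y + y', by push_cast; ring⟩
  | smul a x hx =>
    obtain ⟨c, y, rfl⟩ := hx
    exact ⟨a * c, a * y, by rw [zsmul_eq_mul]; push_cast; ring⟩

theorem eq_intCast_mul_NG (hσ : ∀ x : G, x ∈ Subgroup.zpowers σ) {x : MonoidAlgebra ℤ G}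
    (hx : (1 - tG G σ) * x = 0) :
    x = (x.coeff 1 : ℤ) * NG G σ (Fintype.card G) := by
  have ht : tG G σ * x = x := by linear_combination -hx
  have hpow (k : ℕ) : tG G σ ^ k * x = x := by
    induction k with
    | zero => simp
    | succ k ih => rw [pow_succ, mul_assoc, ht, ih]
  ext g
  rw [coeff_intCast_mul, NG_coeff hσ, mul_one]
  obtain ⟨k, rfl⟩ := mem_powers_iff_mem_zpowers.mpr (hσ g)
  have h := congrArg (fun z : MonoidAlgebra ℤ G => z.coeff (σ ^ k)) (hpow k)
  simpa [tG, MonoidAlgebra.single_pow] using h.symm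

theorem natCast_mul_NG_mul (σ : G) (q : ℕ) (c : ℤ)
    (y : MonoidAlgebra ℤ G) :
    (q : MonoidAlgebra ℤ G) * NG G σ (Fintype.card G) * (c + (1 - tG G σ) * y) =
      ((q * c : ℤ) : MonoidAlgebra ℤ G) * NG G σ (Fintype.card G) := by
  push_cast
  linear_combination (q : MonoidAlgebra ℤ G) * y * one_sub_tG_mul_NG σ

theorem intCast_mul_NG_eq_zero_iff (hσ : ∀ x : G, x ∈ Subgroup.zpowers σ) (c : ℤ) :
    (c : MonoidAlgebra ℤ G) * NG G σ (Fintype.card G) = 0 ↔ c = 0 := by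
  refine ⟨fun h => ?_, fun h => by simp [h]⟩
  have h1 := congrArg (fun z : MonoidAlgebra ℤ G => z.coeff 1) h
  simpa [coeff_intCast_mul, NG_coeff hσ] using h1

end

/-- Let `C` be cyclic of order `p^r` with generator `σ`, `R = ℤ[C]`, and let `T` be the
2-periodic complex with `T_n = R` and differentials `(1-σ)` (from even degrees) and
`p^{i+1}·N` (from odd degrees).  Then `H_n(T) ≅ ℤ/p^{i+1}` for `n` even and
`H_n(T) = 0` for `n` odd. -/
theorem stmt10 (p : ℕ) (hp : p.Prime) (r : ℕ) (G : Type) [CommGroup G] [Fintype G]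
    (hG : Fintype.card G = p ^ r) (σ : G) (hσ : ∀ x : G, x ∈ Subgroup.zpowers σ)
    (i : ℕ) :
    ∀ n : ℤ,
      (Even n → Nonempty (hml' (eT G σ p r i) n ≃+ ZMod (p ^ (i + 1)))) ∧
      (Odd n → Subsingleton (hml' (eT G σ p r i) n)) := by
  intro n
  have hq : 0 < p ^ (i + 1) := pow_pos hp.pos _
  generalize hqq : p ^ (i + 1) = q at hq
  have he (m : ℤ) (hm : Even m) : eT G σ p r i m = 1 - tG G σ := if_pos hm
  have ho (m : ℤ) (hm : Odd m) :
      eT G σ p r i m = (q : MonoidAlgebra ℤ G) * NG G σ (Fintype.card G) := by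
    rw [eT, if_neg (Int.not_even_iff_odd.mpr hm), hG, ← hqq, Nat.cast_pow]
  constructor
  · intro hn
    let K := LinearMap.ker
      (LinearMap.lsmul (MonoidAlgebra ℤ G) (MonoidAlgebra ℤ G) (eT G σ p r i n))
    let f : K →+ ZMod q :=
      { toFun := fun x => ((x.1.coeff 1 : ℤ) : ZMod q)
        map_zero' := by simp
        map_add' := fun x y => by simp }
    have hf : Function.Surjective f := by
      intro z
      obtain ⟨c, rfl⟩ := ZMod.intCast_surjective z
      refine ⟨⟨c * NG G σ (Fintype.card G), ?_⟩, ?_⟩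
      · rw [LinearMap.mem_ker, LinearMap.lsmul_apply, smul_eq_mul, he n hn, mul_left_comm,
          one_sub_tG_mul_NG, mul_zero]
      · change (((c * NG G σ (Fintype.card G) : MonoidAlgebra ℤ G).coeff 1 : ℤ) : ZMod q) = c
        rw [coeff_intCast_mul, NG_coeff hσ, mul_one]
    have hker : (Submodule.comap K.subtype (LinearMap.range
        (LinearMap.lsmul (MonoidAlgebra ℤ G) (MonoidAlgebra ℤ G)
          (eT G σ p r i (n + 1))))).toAddSubgroup = f.ker := by
      ext x
      have hx : (1 - tG G σ) * x.1 = 0 := by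
        rw [← he n hn]
        exact x.2
      rw [Submodule.mem_toAddSubgroup, Submodule.mem_comap, LinearMap.mem_range,
        AddMonoidHom.mem_ker]
      change (∃ y, eT G σ p r i (n + 1) * y = x.1) ↔ ((x.1.coeff 1 : ℤ) : ZMod q) = 0
      rw [ho (n + 1) hn.add_one, ZMod.intCast_zmod_eq_zero_iff_dvd]
      constructor
      · rintro ⟨y, hy⟩
        obtain ⟨c, y, rfl⟩ := exists_eq_intCast_add_mul hσ y
        rw [← hy, natCast_mul_NG_mul, coeff_intCast_mul, NG_coeff hσ, mul_one]
        exact dvd_mul_right _ _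
      · rintro ⟨c, hc⟩
        refine ⟨c, ?_⟩
        rw [eq_intCast_mul_NG hσ hx, hc]
        push_cast
        ring
    exact ⟨(QuotientAddGroup.quotientAddEquivOfEq hker).trans
      (QuotientAddGroup.quotientKerEquivOfSurjective f hf)⟩
  · intro hn
    rw [Submodule.Quotient.subsingleton_iff, eq_top_iff]
    rintro ⟨x, hx⟩ -
    rw [LinearMap.mem_ker, LinearMap.lsmul_apply, smul_eq_mul, ho n hn] at hx
    obtain ⟨c, y, rfl⟩ := exists_eq_intCast_add_mul hσ x
    rw [natCast_mul_NG_mul, intCast_mul_NG_eq_zero_iff hσ, mul_eq_zero] at hx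
    obtain rfl : c = 0 := hx.resolve_left (by exact_mod_cast hq.ne')
    exact ⟨y, by simp [he (n + 1) hn.add_one, sub_mul]⟩
end
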